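/- In the algebra D~, for all n ∈ ℕ with n ≥ 1 one has u2 * x21^{n} = x21^{n} * u2 - 2n * x21^{n} * u1 + n * x1 * x21^{n-1} * (1 + g) and u21^{n} * x2 = x2 * u21^{n} + n * (g + 1) * u1 * u21^{n-1}, where the integer coefficients are taken in k. -/

import Mathlib

/-!
The Hopf algebra `D~` (double of the super Jordan plane, bosonization stripped),
presented by generators x1, x2, u1, u2, g, g' (= g⁻¹), ζ and the relations
listed in the paper.  We realize it as `RingQuot` of the relation `Rel` on the
free algebra on 7 generators.
-/

namespace SuperJordanDouble

variable (k : Type) [Field k]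

noncomputable def fx1 : FreeAlgebra k (Fin 7) := FreeAlgebra.ι k 0
noncomputable def fx2 : FreeAlgebra k (Fin 7) := FreeAlgebra.ι k 1
noncomputable def fu1 : FreeAlgebra k (Fin 7) := FreeAlgebra.ι k 2
noncomputable def fu2 : FreeAlgebra k (Fin 7) := FreeAlgebra.ι k 3
noncomputable def fg  : FreeAlgebra k (Fin 7) := FreeAlgebra.ι k 4
noncomputable def fgi : FreeAlgebra k (Fin 7) := FreeAlgebra.ι k 5
noncomputable def fz  : FreeAlgebra k (Fin 7) := FreeAlgebra.ι k 6
noncomputable def fx21 : FreeAlgebra k (Fin 7) := fx1 k * fx2 k + fx2 k * fx1 k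
noncomputable def fu21 : FreeAlgebra k (Fin 7) := fu1 k * fu2 k + fu2 k * fu1 k

/-- The defining relations of `D~`. -/
inductive Rel : FreeAlgebra k (Fin 7) → FreeAlgebra k (Fin 7) → Prop
  | x1sq  : Rel (fx1 k * fx1 k) 0
  | x2x21 : Rel (fx2 k * fx21 k) (fx21 k * fx2 k + fx1 k * fx21 k)
  | u1sq  : Rel (fu1 k * fu1 k) 0
  | u2u21 : Rel (fu2 k * fu21 k) (fu21 k * fu2 k + fu1 k * fu21 k)
  | ggi   : Rel (fg k * fgi k) 1
  | gig   : Rel (fgi k * fg k) 1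
  | zg    : Rel (fz k * fg k) (fg k * fz k)
  | gx1   : Rel (fg k * fx1 k) (fx1 k * fg k)
  | gx2   : Rel (fg k * fx2 k) (fx2 k * fg k - fx1 k * fg k)
  | u1g   : Rel (fu1 k * fg k) (fg k * fu1 k)
  | u2g   : Rel (fu2 k * fg k) (fg k * fu2 k - fg k * fu1 k)
  | zx1   : Rel (fz k * fx1 k) (fx1 k * fz k + fx1 k)
  | zx2   : Rel (fz k * fx2 k) (fx2 k * fz k + fx2 k)
  | u1z   : Rel (fu1 k * fz k) (fz k * fu1 k + fu1 k)
  | u2z   : Rel (fu2 k * fz k) (fz k * fu2 k + fu2 k)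
  | u1x1  : Rel (fu1 k * fx1 k) (-(fx1 k * fu1 k))
  | u1x2  : Rel (fu1 k * fx2 k) (-(fx2 k * fu1 k) + 1 - fg k)
  | u2x1  : Rel (fu2 k * fx1 k) (-(fx1 k * fu2 k) + 1 - fg k + fx1 k * fu1 k)
  | u2x2  : Rel (fu2 k * fx2 k) (-(fx2 k * fu2 k) + fg k * fz k + fx2 k * fu1 k)

/-- The algebra `D~`. -/
abbrev tD := RingQuot (Rel k)

noncomputable def x1 : tD k := RingQuot.mkAlgHom k (Rel k) (fx1 k)
noncomputable def x2 : tD k := RingQuot.mkAlgHom k (Rel k) (fx2 k)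
noncomputable def u1 : tD k := RingQuot.mkAlgHom k (Rel k) (fu1 k)
noncomputable def u2 : tD k := RingQuot.mkAlgHom k (Rel k) (fu2 k)
noncomputable def g  : tD k := RingQuot.mkAlgHom k (Rel k) (fg k)
noncomputable def gi : tD k := RingQuot.mkAlgHom k (Rel k) (fgi k)
noncomputable def z  : tD k := RingQuot.mkAlgHom k (Rel k) (fz k)
noncomputable def x21 : tD k := x1 k * x2 k + x2 k * x1 k
noncomputable def u21 : tD k := u1 k * u2 k + u2 k * u1 k

/-- `g^n` for `n : ℤ`, where negative powers are interpreted using `g' = g⁻¹`. -/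
noncomputable def gpow (n : ℤ) : tD k :=
  if 0 ≤ n then g k ^ n.toNat else gi k ^ (-n).toNat

end SuperJordanDouble

open SuperJordanDouble

/-- If the commutator `e` of `x` and `a` commutes with `x`, then `x ^ n` and `a` have commutator
`n * e * x ^ (n - 1)`. -/
theorem pow_succ_mul_of_mul_eq_add {R : Type*} [Ring R] {x a e : R}
    (hxa : x * a = a * x + e) (hxe : Commute x e) (n : ℕ) :
    x ^ (n + 1) * a = a * x ^ (n + 1) + (n + 1) • (e * x ^ n) := by
  induction n with
  | zero => simp [hxa]
  | succ n ih =>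
    rw [pow_succ' x (n + 1), mul_assoc, ih, mul_add, ← mul_assoc, hxa, mul_smul_comm,
      ← mul_assoc x e, hxe.eq, mul_assoc e x, ← pow_succ', add_mul, mul_assoc,
      succ_nsmul _ (n + 1)]
    abel

theorem mul_mul_of_mul_eq {M : Type*} [Semigroup M] {a b c : M} (h : a * b = c) (d : M) :
    a * (b * d) = c * d := by
  rw [← mul_assoc, h]

theorem mul_superbracket_comm_of_mul_eq_sub {R : Type*} [Ring R] {x y g : R}
    (hgx : g * x = x * g) (hgy : g * y = y * g - x * g) (hxx : x * x = 0) :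
    g * (x * y + y * x) = (x * y + y * x) * g := by
  simp only [hgx, hgy, mul_mul_of_mul_eq hgx, mul_mul_of_mul_eq hgy, mul_mul_of_mul_eq hxx,
    mul_add, add_mul, mul_sub, sub_mul, mul_assoc, zero_mul]
  abel

theorem superbracket_mul_comm_of_mul_eq_sub {R : Type*} [Ring R] {u v g : R}
    (hug : u * g = g * u) (hvg : v * g = g * v - g * u) (huu : u * u = 0) :
    g * (u * v + v * u) = (u * v + v * u) * g := by
  simp only [hug, hvg, huu, mul_mul_of_mul_eq hug, mul_mul_of_mul_eq hvg, mul_add, add_mul,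
    mul_sub, sub_mul, mul_assoc, mul_zero]
  abel

theorem mul_superbracket_comm_of_mul_eq_neg {R : Type*} [Ring R] {x y u g : R}
    (hux : u * x = -(x * u)) (huy : u * y = -(y * u) + 1 - g) (hgx : g * x = x * g) :
    u * (x * y + y * x) = (x * y + y * x) * u := by
  simp only [hux, huy, hgx, mul_mul_of_mul_eq hux, mul_mul_of_mul_eq huy, mul_add,
    add_mul, mul_sub, sub_mul, mul_neg, neg_mul, mul_assoc, mul_one, one_mul]
  abel

theorem superbracket_mul_eq_mul_superbracket_add {R : Type*} [Ring R] {x y u v g z : R}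
    (hgx : g * x = x * g) (hgy : g * y = y * g - x * g) (hzx : z * x = x * z + x)
    (hux : u * x = -(x * u)) (huy : u * y = -(y * u) + 1 - g)
    (hvx : v * x = -(x * v) + 1 - g + x * u) (hvy : v * y = -(y * v) + g * z + y * u) :
    (x * y + y * x) * v = v * (x * y + y * x) + (2 * ((x * y + y * x) * u) - x * (1 + g)) := by
  simp only [hgx, hgy, hzx, hux, huy, hvx, hvy, mul_mul_of_mul_eq hgx,
    mul_mul_of_mul_eq hvx, mul_mul_of_mul_eq hvy, mul_add, add_mul, mul_sub, sub_mul,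
    mul_neg, neg_mul, mul_assoc, mul_one, one_mul, two_mul]
  abel

theorem superbracket_mul_eq_mul_superbracket_add_mul {R : Type*} [Ring R] {y u v g z : R}
    (huu : u * u = 0) (hug : u * g = g * u) (hvg : v * g = g * v - g * u)
    (huz : u * z = z * u + u) (huy : u * y = -(y * u) + 1 - g)
    (hvy : v * y = -(y * v) + g * z + y * u) :
    (u * v + v * u) * y = y * (u * v + v * u) + (g + 1) * u := by
  simp only [huu, hvg, huz, huy, hvy, mul_mul_of_mul_eq hug, mul_mul_of_mul_eq huy,
    mul_mul_of_mul_eq hvy, mul_add, add_mul, mul_sub, sub_mul, mul_neg, neg_mul, mul_assoc,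
    mul_one, one_mul, mul_zero]
  abel

namespace SuperJordanDouble

variable (k : Type) [Field k]

theorem x1sq : x1 k * x1 k = 0 := by
  simpa [x1] using RingQuot.mkAlgHom_rel k (Rel.x1sq (k := k))

theorem u1sq : u1 k * u1 k = 0 := by
  simpa [u1] using RingQuot.mkAlgHom_rel k (Rel.u1sq (k := k))

theorem gx1 : g k * x1 k = x1 k * g k := by
  simpa [g, x1] using RingQuot.mkAlgHom_rel k (Rel.gx1 (k := k))

theorem gx2 : g k * x2 k = x2 k * g k - x1 k * g k := by
  simpa [g, x1, x2] using RingQuot.mkAlgHom_rel k (Rel.gx2 (k := k))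

theorem u1g : u1 k * g k = g k * u1 k := by
  simpa [g, u1] using RingQuot.mkAlgHom_rel k (Rel.u1g (k := k))

theorem u2g : u2 k * g k = g k * u2 k - g k * u1 k := by
  simpa [g, u1, u2] using RingQuot.mkAlgHom_rel k (Rel.u2g (k := k))

theorem zx1 : z k * x1 k = x1 k * z k + x1 k := by
  simpa [x1, z] using RingQuot.mkAlgHom_rel k (Rel.zx1 (k := k))

theorem u1z : u1 k * z k = z k * u1 k + u1 k := by
  simpa [u1, z] using RingQuot.mkAlgHom_rel k (Rel.u1z (k := k))

theorem u1x1 : u1 k * x1 k = -(x1 k * u1 k) := by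
  simpa [u1, x1] using RingQuot.mkAlgHom_rel k (Rel.u1x1 (k := k))

theorem u1x2 : u1 k * x2 k = -(x2 k * u1 k) + 1 - g k := by
  simpa [g, u1, x2] using RingQuot.mkAlgHom_rel k (Rel.u1x2 (k := k))

theorem u2x1 : u2 k * x1 k = -(x1 k * u2 k) + 1 - g k + x1 k * u1 k := by
  simpa [g, u1, u2, x1] using RingQuot.mkAlgHom_rel k (Rel.u2x1 (k := k))

theorem u2x2 : u2 k * x2 k = -(x2 k * u2 k) + g k * z k + x2 k * u1 k := by
  simpa [g, u1, u2, x2, z] using RingQuot.mkAlgHom_rel k (Rel.u2x2 (k := k))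

theorem commute_x1_x21 : Commute (x1 k) (x21 k) := by
  simp only [Commute, SemiconjBy, x21, mul_add, add_mul, mul_assoc, x1sq, mul_zero]
  simp only [← mul_assoc, x1sq, zero_mul, zero_add, add_zero]

theorem commute_u1_u21 : Commute (u1 k) (u21 k) := by
  simp only [Commute, SemiconjBy, u21, mul_add, add_mul, mul_assoc, u1sq, mul_zero]
  simp only [← mul_assoc, u1sq, zero_mul, zero_add, add_zero]

theorem commute_g_x21 : Commute (g k) (x21 k) :=
  mul_superbracket_comm_of_mul_eq_sub (gx1 k) (gx2 k) (x1sq k)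

theorem commute_g_u21 : Commute (g k) (u21 k) :=
  superbracket_mul_comm_of_mul_eq_sub (u1g k) (u2g k) (u1sq k)

theorem commute_u1_x21 : Commute (u1 k) (x21 k) :=
  mul_superbracket_comm_of_mul_eq_neg (u1x1 k) (u1x2 k) (gx1 k)

theorem x21_mul_u2 :
    x21 k * u2 k = u2 k * x21 k + (2 * (x21 k * u1 k) - x1 k * (1 + g k)) :=
  superbracket_mul_eq_mul_superbracket_add (gx1 k) (gx2 k) (zx1 k) (u1x1 k) (u1x2 k)
    (u2x1 k) (u2x2 k)

theorem u21_mul_x2 : u21 k * x2 k = x2 k * u21 k + (g k + 1) * u1 k :=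
  superbracket_mul_eq_mul_superbracket_add_mul (u1sq k) (u1g k) (u2g k) (u1z k) (u1x2 k) (u2x2 k)

end SuperJordanDouble

/-- In `D~`, for `n ≥ 1`,
`u2 x21^{n} = x21^{n} u2 - 2n x21^{n} u1 + n x1 x21^{n-1} (1 + g)` and
`u21^{n} x2 = x2 u21^{n} + n (g + 1) u1 u21^{n-1}`. -/
theorem superJordanDouble_u2_x21_pow_comm (k : Type) [Field k]
    (hchar : (2 : k) ≠ 0) (n : ℕ) (hn : 1 ≤ n) :
    (u2 k * x21 k ^ n =
      x21 k ^ n * u2 k - ((2 * n : ℕ) : k) • (x21 k ^ n * u1 k) +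
        (n : k) • (x1 k * x21 k ^ (n - 1) * (1 + g k))) ∧
    (u21 k ^ n * x2 k =
      x2 k * u21 k ^ n + (n : k) • ((g k + 1) * u1 k * u21 k ^ (n - 1))) := by
  obtain ⟨m, rfl⟩ : ∃ m, n = m + 1 := ⟨n - 1, by omega⟩
  simp only [Nat.cast_smul_eq_nsmul, Nat.add_sub_cancel]
  have hx1 := commute_x1_x21 k
  have hg := commute_g_x21 k
  have hu1 := commute_u1_x21 k
  have hx : Commute (x21 k) (2 * (x21 k * u1 k) - x1 k * (1 + g k)) :=
    ((Commute.ofNat_right _ 2).mul_right ((Commute.refl _).mul_right hu1.symm)).sub_right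
      (hx1.symm.mul_right ((Commute.one_right _).add_right hg.symm))
  have hu : Commute (u21 k) ((g k + 1) * u1 k) :=
    ((commute_g_u21 k).symm.add_right (Commute.one_right _)).mul_right (commute_u1_u21 k).symm
  refine ⟨?_, pow_succ_mul_of_mul_eq_add (u21_mul_x2 k) hu m⟩
  rw [pow_succ_mul_of_mul_eq_add (x21_mul_u2 k) hx m, ← (hx.pow_left m).eq, mul_sub,
    (hx1.pow_right m).eq, pow_succ (x21 k) m]
  simp only [mul_assoc, two_mul, mul_add, smul_sub, add_smul, smul_add]
  abel
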